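/- Let R = S ×_k T be a non-trivial fiber product. Assume that depth(S) = 0 and that S or T is not artinian. Let M, N be nonzero finitely generated R-modules. If Ext_R^i(M, N) = 0 for all sufficiently large i, then M is free over R. -/

import Mathlib

open CategoryTheory Opposite IsLocalRing

noncomputable section

set_option maxHeartbeats 1000000
set_option synthInstance.maxHeartbeats 1000000

/-- Vanishing of `Tor_i^A(M, N)`. -/
abbrev TorZero (A : Type) [CommRing A] (M N : Type) [AddCommGroup M] [Module A M]
    [AddCommGroup N] [Module A N] (i : ℕ) : Prop :=
  Subsingleton (((Tor (ModuleCat A) i).obj (ModuleCat.of A M)).obj (ModuleCat.of A N))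

/-- Vanishing of `Ext^i_A(M, N)`. -/
abbrev ExtZero (A : Type) [CommRing A] (M N : Type) [AddCommGroup M] [Module A M]
    [AddCommGroup N] [Module A N] (i : ℕ) : Prop :=
  Subsingleton (((Ext A (ModuleCat A) i).obj (op (ModuleCat.of A M))).obj (ModuleCat.of A N))

/-- `M` has projective dimension at most `n` over `A`:
`Ext^i_A(M, -) = 0` for all `i > n`. -/
def PdLE (A : Type) [CommRing A] (M : Type) [AddCommGroup M] [Module A M] (n : ℕ) : Prop :=
  ∀ (N : ModuleCat A) (i : ℕ), n < i →
    Subsingleton (((Ext A (ModuleCat A) i).obj (op (ModuleCat.of A M))).obj N)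

/-- `N` has injective dimension at most `n` over `A`:
`Ext^i_A(-, N) = 0` for all `i > n`. -/
def IdLE (A : Type) [CommRing A] (N : Type) [AddCommGroup N] [Module A N] (n : ℕ) : Prop :=
  ∀ (X : ModuleCat A) (i : ℕ), n < i →
    Subsingleton (((Ext A (ModuleCat A) i).obj (op X)).obj (ModuleCat.of A N))

/-- The depth of a module over a noetherian local ring, as an extended natural number:
`inf { i | Ext^i_A(k, M) ≠ 0 }`. -/
def depthM (A : Type) [CommRing A] [IsLocalRing A] (M : Type) [AddCommGroup M]
    [Module A M] : ℕ∞ :=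
  sInf {n : ℕ∞ | ∃ i : ℕ, n = i ∧
    ¬ Subsingleton (((Ext A (ModuleCat A) i).obj
        (op (ModuleCat.of A (A ⧸ maximalIdeal A)))).obj (ModuleCat.of A M))}

/-- The fiber product `S ×ₖ T` as a subring of `S × T`. -/
def fiberProd {S T k : Type} [CommRing S] [CommRing T] [CommRing k]
    (πS : S →+* k) (πT : T →+* k) : Subring (S × T) :=
  RingHom.eqLocus (πS.comp (RingHom.fst S T)) (πT.comp (RingHom.snd S T))

/-- The projection from the fiber product to `S`. -/
def ρS {S T k : Type} [CommRing S] [CommRing T] [CommRing k]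
    (πS : S →+* k) (πT : T →+* k) : ↥(fiberProd πS πT) →+* S :=
  (RingHom.fst S T).comp (fiberProd πS πT).subtype

/-- The projection from the fiber product to `T`. -/
def ρT {S T k : Type} [CommRing S] [CommRing T] [CommRing k]
    (πS : S →+* k) (πT : T →+* k) : ↥(fiberProd πS πT) →+* T :=
  (RingHom.snd S T).comp (fiberProd πS πT).subtype

/-- The `i`-th Betti number of a module `M` over a noetherian local ring `A`:
the `k`-dimension of `Tor_i^A(M, k) ⊗_A k`; since `Tor_i^A(M, k)` is annihilated
by the maximal ideal, this is `dim_k Tor_i^A(M, k)`. -/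
noncomputable def betti (A : Type) [CommRing A] [IsLocalRing A] (M : Type) [AddCommGroup M]
    [Module A M] (i : ℕ) : ℕ :=
  let X : ModuleCat A :=
    ((Tor (ModuleCat A) i).obj (ModuleCat.of A M)).obj (ModuleCat.of A (A ⧸ maximalIdeal A))
  Module.finrank (A ⧸ maximalIdeal A) (X ⧸ (maximalIdeal A • (⊤ : Submodule A X)))

/-- `M` is a first syzygy over `A` of a finitely generated `A`-module, i.e. `M` embeds
into a finite free `A`-module (as the kernel of `F ↠ L` for the quotient `L`). -/
def IsFirstSyzygy (A : Type) [CommRing A] (M : Type) [AddCommGroup M] [Module A M] : Prop :=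
  ∃ (n : ℕ) (f : M →ₗ[A] (Fin n → A)), Function.Injective f

/-- Vanishing of `Ext^i_R(L, N)`, computed in the derived category. -/
abbrev ExtVanishes (R : Type) [CommRing R] (L N : Type) [AddCommGroup L] [Module R L]
    [AddCommGroup N] [Module R N] (i : ℕ) : Prop :=
  Subsingleton (Abelian.Ext (ModuleCat.of R L) (ModuleCat.of R N) i)

namespace ExtVanishes

section Comparison

variable {R : Type} [CommRing R] {X Y : ModuleCat R}

theorem of_extZero {n : ℕ} {L N : Type} [AddCommGroup L] [Module R L]
    [AddCommGroup N] [Module R N] (h : ExtZero R L N (n + 1)) : ExtVanishes R L N (n + 1) := by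
  let P := projectiveResolution (ModuleCat.of R L)
  have hz : Limits.IsZero ((P.complex.linearYonedaObj R (ModuleCat.of R N)).homology (n + 1)) :=
    (ModuleCat.isZero_of_iff_subsingleton.mpr h).of_iso (P.isoExt (n + 1) _).symm
  rw [← HomologicalComplex.exactAt_iff_isZero_homology,
    HomologicalComplex.exactAt_iff' _ n (n + 1) (n + 2) (by simp) (by simp),
    ShortComplex.moduleCat_exact_iff] at hz
  refine subsingleton_of_forall_eq 0 fun α => ?_
  obtain ⟨f, hf, rfl⟩ := P.extMk_surjective α (n + 2) rfl
  rw [P.extMk_eq_zero_iff f (n + 2) rfl hf n rfl]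
  exact hz f hf

theorem extZero_zero_of_forall_eq_zero {L N : Type} [AddCommGroup L] [Module R L]
    [AddCommGroup N] [Module R N] (h : ∀ f : L →ₗ[R] N, f = 0) : ExtZero R L N 0 := by
  let P := projectiveResolution (ModuleCat.of R L)
  suffices hz : Limits.IsZero ((P.complex.linearYonedaObj R (ModuleCat.of R N)).homology 0) from
    ModuleCat.subsingleton_of_isZero (hz.of_iso (P.isoExt 0 (ModuleCat.of R N)))
  rw [← HomologicalComplex.exactAt_iff_isZero_homology,
    HomologicalComplex.exactAt_iff' _ 0 0 1 (by simp) (by simp),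
    ShortComplex.moduleCat_exact_iff]
  intro f hf
  refine ⟨0, ?_⟩
  let f' : P.complex.X 0 ⟶ ModuleCat.of R N := f
  have hf' : P.complex.d 1 0 ≫ f' = 0 := hf
  suffices f' = 0 by rw [map_zero]; exact this.symm
  have hd : P.exact₀.desc f' hf' = 0 := ModuleCat.hom_ext (h _)
  rw [← P.exact₀.g_desc f' hf', hd, Limits.comp_zero]

end Comparison

variable {R : Type} [CommRing R] {A B C N : Type}
  [AddCommGroup A] [Module R A] [AddCommGroup B] [Module R B] [AddCommGroup C] [Module R C]
  [AddCommGroup N] [Module R N]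

theorem of_retract {i : ℕ} (s : A →ₗ[R] B) (r : B →ₗ[R] A) (hrs : r ∘ₗ s = LinearMap.id)
    (h : ExtVanishes R B N i) : ExtVanishes R A N i := by
  refine subsingleton_of_forall_eq 0 fun α => ?_
  have h1 : ModuleCat.ofHom s ≫ ModuleCat.ofHom r = 𝟙 (ModuleCat.of R A) := by
    rw [← ModuleCat.ofHom_comp, hrs]; rfl
  rw [← Abelian.Ext.mk₀_id_comp α, ← h1, ← Abelian.Ext.mk₀_comp_mk₀_assoc,
    Subsingleton.elim ((Abelian.Ext.mk₀ (ModuleCat.ofHom r)).comp α (zero_add i)) 0,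
    Abelian.Ext.comp_zero]

theorem of_subsingleton [Subsingleton A] (i : ℕ) : ExtVanishes R A N i := by
  refine subsingleton_of_forall_eq 0 fun α => ?_
  rw [← Abelian.Ext.mk₀_id_comp α, (ModuleCat.isZero_of_subsingleton (ModuleCat.of R A)).eq_of_src
    (𝟙 _) 0, Abelian.Ext.mk₀_zero, Abelian.Ext.zero_comp]

theorem of_projective [Module.Projective R A] (i : ℕ) : ExtVanishes R A N (i + 1) :=
  Abelian.Ext.subsingleton_of_projective _ _ i

theorem zero_iff : ExtVanishes R A N 0 ↔ ∀ f : A →ₗ[R] N, f = 0 := by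
  constructor
  · intro h f
    have : ModuleCat.ofHom f = 0 := by
      rw [← Abelian.Ext.mk₀_eq_zero_iff]; exact Subsingleton.elim _ _
    simpa using congrArg ModuleCat.Hom.hom this
  · intro h
    refine subsingleton_of_forall_eq 0 fun α => ?_
    obtain ⟨f, rfl⟩ := (Abelian.Ext.mk₀_bijective _ _).2 α
    rw [Abelian.Ext.mk₀_eq_zero_iff]
    ext1
    exact h f.hom

variable {f : A →ₗ[R] B} {g : B →ₗ[R] C}

/-- The short complex of modules attached to an exact pair of linear maps. -/
abbrev complex (hfg : Function.Exact f g) : ShortComplex (ModuleCat R) :=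
  ShortComplex.mk (ModuleCat.ofHom f) (ModuleCat.ofHom g) (by
    rw [← ModuleCat.ofHom_comp, hfg.linearMap_comp_eq_zero]; rfl)

theorem complex_shortExact (hf : Function.Injective f) (hfg : Function.Exact f g)
    (hg : Function.Surjective g) : (complex hfg).ShortExact where
  exact := (ShortComplex.ShortExact.moduleCat_exact_iff_function_exact _).mpr hfg
  mono_f := (ModuleCat.mono_iff_injective _).mpr hf
  epi_g := (ModuleCat.epi_iff_surjective _).mpr hg

theorem middle {i : ℕ} (hf : Function.Injective f) (hfg : Function.Exact f g)
    (hg : Function.Surjective g) (hA : ExtVanishes R A N i) (hC : ExtVanishes R C N i) :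
    ExtVanishes R B N i := by
  refine subsingleton_of_forall_eq 0 fun α => ?_
  obtain ⟨β, rfl⟩ := Abelian.Ext.contravariant_sequence_exact₂
    (complex_shortExact hf hfg hg) _ α (hA.elim _ _)
  rw [hC.elim β 0, Abelian.Ext.comp_zero]

theorem right {i : ℕ} (hf : Function.Injective f) (hfg : Function.Exact f g)
    (hg : Function.Surjective g) (hA : ExtVanishes R A N i) (hB : ExtVanishes R B N (i + 1)) :
    ExtVanishes R C N (i + 1) := by
  refine subsingleton_of_forall_eq 0 fun α => ?_
  obtain ⟨β, rfl⟩ := Abelian.Ext.contravariant_sequence_exact₃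
    (complex_shortExact hf hfg hg) _ α (hB.elim _ _) (add_comm 1 i)
  rw [hA.elim β 0, Abelian.Ext.comp_zero]

theorem left {i : ℕ} (hf : Function.Injective f) (hfg : Function.Exact f g)
    (hg : Function.Surjective g) (hB : ExtVanishes R B N i) (hC : ExtVanishes R C N (i + 1)) :
    ExtVanishes R A N i := by
  refine subsingleton_of_forall_eq 0 fun α => ?_
  obtain ⟨β, rfl⟩ := Abelian.Ext.contravariant_sequence_exact₁
    (complex_shortExact hf hfg hg) _ α (add_comm 1 i) (hC.elim _ _)
  rw [hB.elim β 0, Abelian.Ext.comp_zero]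

theorem finite_ext [IsNoetherianRing R] [Module.Finite R N] (i : ℕ) :
    ∀ (A : Type) [AddCommGroup A] [Module R A] [Module.Finite R A],
      Module.Finite R (Abelian.Ext (ModuleCat.of R A) (ModuleCat.of R N) i) := by
  induction i with
  | zero =>
    intro A _ _ _
    obtain ⟨n, p, hp⟩ := Module.Finite.exists_fin' R A
    have : Module.Finite R (A →ₗ[R] N) :=
      Module.Finite.of_injective (LinearMap.lcomp R N p) fun f g h => by
        ext x
        obtain ⟨y, rfl⟩ := hp x
        exact LinearMap.congr_fun h y
    exact Module.Finite.equiv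
      ((Abelian.Ext.linearEquiv₀ (R := R) (X := ModuleCat.of R A) (Y := ModuleCat.of R N)).trans
        ModuleCat.homLinearEquiv).symm
  | succ i ih =>
    intro A _ _ _
    obtain ⟨n, p, hp⟩ := Module.Finite.exists_fin' R A
    have hs := complex_shortExact (f := (LinearMap.ker p).subtype) (g := p)
      (Submodule.injective_subtype _) (LinearMap.exact_subtype_ker_map p) hp
    have := ih (LinearMap.ker p)
    refine Module.Finite.of_surjective
      (Abelian.Ext.precompOfLinear hs.extClass R (ModuleCat.of R N) (add_comm 1 i)) fun α => ?_
    have : ExtVanishes R (Fin n → R) N (i + 1) := of_projective i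
    exact Abelian.Ext.contravariant_sequence_exact₃ hs _ α (this.elim _ _) (add_comm 1 i)

theorem of_smul_exact [IsLocalRing R] [IsNoetherianRing R] [Module.Finite R N] [Module.Finite R A]
    {i : ℕ} {x : R} (hx : x ∈ maximalIdeal R) {g : A →ₗ[R] C}
    (hf : Function.Injective (LinearMap.lsmul R A x))
    (hfg : Function.Exact (LinearMap.lsmul R A x) g)
    (hg : Function.Surjective g) (hC : ExtVanishes R C N (i + 1)) :
    ExtVanishes R A N i := by
  have := finite_ext (R := R) (N := N) i A
  have key : (⊤ : Submodule R (Abelian.Ext (ModuleCat.of R A) (ModuleCat.of R N) i)) ≤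
      maximalIdeal R • ⊤ := by
    rintro α -
    obtain ⟨β, rfl⟩ := Abelian.Ext.contravariant_sequence_exact₁
      (complex_shortExact hf hfg hg) _ α (add_comm 1 i) (hC.elim _ _)
    have h1 : ModuleCat.ofHom (LinearMap.lsmul R A x) = x • 𝟙 (ModuleCat.of R A) := by
      ext; rfl
    have h2 : (Abelian.Ext.mk₀ (ModuleCat.ofHom (LinearMap.lsmul R A x))).comp β (zero_add i)
        = x • β := by
      rw [h1, Abelian.Ext.mk₀_smul, Abelian.Ext.smul_comp, Abelian.Ext.mk₀_id_comp]
    change (Abelian.Ext.mk₀ (ModuleCat.ofHom (LinearMap.lsmul R A x))).comp β (zero_add i) ∈ _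
    rw [h2]
    exact Submodule.smul_mem_smul hx trivial
  have := Submodule.eq_bot_of_le_smul_of_le_jacobson_bot _ _ Module.Finite.fg_top key
    (IsLocalRing.maximalIdeal_le_jacobson _)
  exact (Submodule.subsingleton_iff R).mp (subsingleton_of_bot_eq_top this.symm)

end ExtVanishes

theorem Ideal.exact_lsmul_factor {R : Type} [CommRing R] (J : Ideal R) (x : R) :
    Function.Exact (LinearMap.lsmul R (R ⧸ J) x)
      (Submodule.factor (le_sup_left : J ≤ J ⊔ Ideal.span {x})) := by
  intro y
  obtain ⟨y, rfl⟩ := Submodule.mkQ_surjective J y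
  constructor
  · intro hy
    have : y ∈ J ⊔ Ideal.span {x} := (Submodule.Quotient.mk_eq_zero _).mp hy
    obtain ⟨a, ha, b, hb, rfl⟩ := Submodule.mem_sup.mp this
    obtain ⟨c, rfl⟩ := Ideal.mem_span_singleton'.mp hb
    refine ⟨Submodule.Quotient.mk c, (Submodule.Quotient.eq J).mpr ?_⟩
    have : x • c - (a + c * x) = -a := by simp only [smul_eq_mul]; ring
    rw [this]
    exact J.neg_mem ha
  · rintro ⟨z, hz⟩
    obtain ⟨z, rfl⟩ := Submodule.mkQ_surjective J z
    rw [← hz]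
    exact (Submodule.Quotient.mk_eq_zero _).mpr
      (Ideal.mem_sup_right (Ideal.mul_mem_right _ _ (Ideal.mem_span_singleton_self x)))

section Local

variable {R : Type} [CommRing R] [IsLocalRing R] [IsNoetherianRing R]
  {N : Type} [AddCommGroup N] [Module R N]

theorem ExtVanishes.quotient_of_residueField [Module.Finite R N] {n : ℕ}
    (h : ∀ i ≥ n, ExtVanishes R (R ⧸ maximalIdeal R) N i) (J : Ideal R) :
    ∀ i ≥ n, ExtVanishes R (R ⧸ J) N i := by
  induction J using IsNoetherian.induction with
  | hgt J ih =>
    intro i hi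
    by_cases hJt : J = ⊤
    · subst hJt
      have : Subsingleton (R ⧸ (⊤ : Ideal R)) := Ideal.Quotient.subsingleton_iff.mpr rfl
      exact ExtVanishes.of_subsingleton i
    by_cases hJm : J = maximalIdeal R
    · exact hJm ▸ h i hi
    obtain ⟨x, hxm, hxJ⟩ := Set.exists_of_ssubset
      (lt_of_le_of_ne (le_maximalIdeal hJt) hJm : J < maximalIdeal R)
    have hlt : J < J ⊔ Ideal.span {x} := lt_of_le_of_ne le_sup_left fun hh => hxJ <| by
      rw [hh]; exact Ideal.mem_sup_right (Ideal.mem_span_singleton_self x)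
    let g : (R ⧸ J) →ₗ[R] R ⧸ (J ⊔ Ideal.span {x}) := Submodule.factor le_sup_left
    have hg : Function.Surjective g := Submodule.factor_surjective _
    have hexact : Function.Exact (LinearMap.lsmul R (R ⧸ J) x) g := Ideal.exact_lsmul_factor J x
    by_cases hinj : Function.Injective (LinearMap.lsmul R (R ⧸ J) x)
    · exact ExtVanishes.of_smul_exact hxm hinj hexact hg (ih _ hlt (i + 1) (by omega))
    · let φ : R →ₗ[R] R ⧸ J := LinearMap.lsmul R (R ⧸ J) x ∘ₗ J.mkQ
      have hJφ : J < LinearMap.ker φ := by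
        refine lt_of_le_of_ne (fun a ha => ?_) fun hh => hinj ?_
        · have : J.mkQ a = 0 := (Submodule.Quotient.mk_eq_zero _).mpr ha
          simp [φ, LinearMap.mem_ker, this]
        · rw [injective_iff_map_eq_zero]
          intro a ha
          obtain ⟨a, rfl⟩ := Submodule.mkQ_surjective J a
          refine (Submodule.Quotient.mk_eq_zero _).mpr ?_
          rw [hh]
          exact ha
      refine ExtVanishes.middle (f := (LinearMap.ker φ).liftQ φ le_rfl) (g := g) ?_ ?_ hg
        (ih _ hJφ i hi) (ih _ hlt i hi)
      · exact LinearMap.ker_eq_bot.mp (Submodule.ker_liftQ_eq_bot _ _ _ le_rfl)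
      · rw [LinearMap.exact_iff] at hexact ⊢
        rw [hexact, Submodule.range_liftQ,
          LinearMap.range_comp_of_range_eq_top _ (Submodule.range_mkQ J)]

/-- Over a local ring of depth zero with a non-maximal prime, `Ext^i(k, N)` cannot vanish for all
large `i` unless `N = 0`. -/
theorem subsingleton_of_ext_residueField [Module.Finite R N] {s : R} (hs : s ≠ 0)
    (hsm : ∀ x ∈ maximalIdeal R, x * s = 0) {p : Ideal R} [p.IsPrime] (hp : p ≠ maximalIdeal R)
    {n : ℕ} (h : ∀ i ≥ n, ExtVanishes R (R ⧸ maximalIdeal R) N i) : Subsingleton N := by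
  have hker : LinearMap.ker (LinearMap.toSpanSingleton R R s) = maximalIdeal R := by
    refine le_antisymm (le_maximalIdeal fun ht => hs ?_) hsm
    have : (1 : R) ∈ LinearMap.ker (LinearMap.toSpanSingleton R R s) := ht ▸ trivial
    simpa using this
  have descend : ∀ n, ∀ i ≥ 1, (∀ j ≥ i + n, ExtVanishes R (R ⧸ maximalIdeal R) N j) →
      ExtVanishes R (R ⧸ maximalIdeal R) N i := by
    intro n
    induction n with
    | zero => intro i _ hi; exact hi i le_rfl
    | succ n ih =>
      intro i hi hj
      refine ih i hi fun j hjn => ?_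
      have := ExtVanishes.quotient_of_residueField hj (Ideal.span {s}) (j + 1) (by omega)
      obtain ⟨j, rfl⟩ : ∃ j', j = j' + 1 := ⟨j - 1, by omega⟩
      refine ExtVanishes.left
        (f := (maximalIdeal R).liftQ (LinearMap.toSpanSingleton R R s) hker.ge)
        (g := (Ideal.span {s}).mkQ) ?_ ?_ (Submodule.mkQ_surjective _)
        (ExtVanishes.of_projective j) this
      · exact LinearMap.ker_eq_bot.mp (Submodule.ker_liftQ_eq_bot _ _ _ hker.le)
      · rw [LinearMap.exact_iff, Submodule.range_liftQ, Submodule.ker_mkQ,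
          LinearMap.range_toSpanSingleton]
  have hpos : ∀ i ≥ 1, ExtVanishes R (R ⧸ maximalIdeal R) N i := fun i hi =>
    descend n i hi fun j hj => h j (by omega)
  have hquot := ExtVanishes.quotient_of_residueField hpos
  obtain ⟨x, hxm, hxp⟩ := Set.exists_of_ssubset
    (lt_of_le_of_ne (le_maximalIdeal Ideal.IsPrime.ne_top') hp : p < maximalIdeal R)
  have hinj : Function.Injective (LinearMap.lsmul R (R ⧸ p) x) := by
    rw [injective_iff_map_eq_zero]
    intro a ha
    obtain ⟨a, rfl⟩ := Submodule.mkQ_surjective p a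
    refine (Submodule.Quotient.mk_eq_zero _).mpr ?_
    have : x * a ∈ p := (Submodule.Quotient.mk_eq_zero _).mp ha
    exact (Ideal.IsPrime.mem_or_mem ‹_› this).resolve_left hxp
  have hp0 : ExtVanishes R (R ⧸ p) N 0 :=
    ExtVanishes.of_smul_exact hxm hinj (Ideal.exact_lsmul_factor p x)
      (Submodule.factor_surjective _)
      (hquot _ 1 le_rfl)
  have hk0 : ExtVanishes R (R ⧸ maximalIdeal R) N 0 := by
    rw [ExtVanishes.zero_iff] at hp0 ⊢
    intro f
    have hpm : p ≤ maximalIdeal R := le_maximalIdeal Ideal.IsPrime.ne_top'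
    have := hp0 (f ∘ₗ Submodule.factor hpm)
    ext
    exact LinearMap.congr_fun this (Submodule.Quotient.mk 1)
  have hbot := ExtVanishes.zero_iff.mp <|
    ExtVanishes.quotient_of_residueField (n := 0) (fun i _ => by
      rcases Nat.eq_zero_or_pos i with rfl | hi
      exacts [hk0, hpos i hi]) (⊥ : Ideal R) 0 le_rfl
  refine subsingleton_of_forall_eq 0 fun y => ?_
  have := LinearMap.congr_fun (hbot ((⊥ : Ideal R).liftQ (LinearMap.toSpanSingleton R N y) bot_le))
    (Submodule.Quotient.mk 1)
  have h1 : LinearMap.toSpanSingleton R N y 1 = 0 := this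
  simpa using h1

end Local

section Cover

variable {R : Type} [CommRing R] [IsLocalRing R]

/-- A finitely generated module over a local ring has a minimal free cover. -/
theorem IsLocalRing.exists_minimal_cover (M : Type) [AddCommGroup M] [Module R M]
    [Module.Finite R M] :
    ∃ (n : ℕ) (φ : (Fin n → R) →ₗ[R] M), Function.Surjective φ ∧
      ∀ v ∈ LinearMap.ker φ, ∀ i, v i ∈ maximalIdeal R := by
  classical
  have hex : ∃ n, ∃ φ : (Fin n → R) →ₗ[R] M, Function.Surjective φ := Module.Finite.exists_fin' R M
  obtain ⟨φ, hφ⟩ := Nat.find_spec hex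
  refine ⟨_, φ, hφ, fun v hv i => ?_⟩
  by_contra hvi
  have hu : IsUnit (v i) := by simpa [mem_maximalIdeal] using hvi
  generalize hn : Nat.find hex = n at *
  obtain ⟨m, rfl⟩ : ∃ m, n = m + 1 := ⟨n - 1, by have := i.2; omega⟩
  let ι : (Fin m → R) →ₗ[R] (Fin (m + 1) → R) :=
    { toFun := fun u => i.insertNth (0 : R) u
      map_add' := fun u w => by
        ext j; revert j; rw [Fin.forall_iff_succAbove i]; simp
      map_smul' := fun c u => by
        ext j; revert j; rw [Fin.forall_iff_succAbove i]; simp }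
  refine Nat.find_min hex (m := m) (by omega) ⟨φ ∘ₗ ι, fun y => ?_⟩
  obtain ⟨w, rfl⟩ := hφ y
  obtain ⟨u, hu⟩ := hu.exists_right_inv
  refine ⟨fun j => w (i.succAbove j) - w i * u * v (i.succAbove j), ?_⟩
  have : ι (fun j => w (i.succAbove j) - w i * u * v (i.succAbove j)) = w - (w i * u) • v := by
    ext j; revert j; rw [Fin.forall_iff_succAbove i]
    refine ⟨?_, fun j => by simp [ι]⟩
    simp only [ι, LinearMap.coe_mk, AddHom.coe_mk, Fin.insertNth_apply_same, Pi.sub_apply,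
      Pi.smul_apply, smul_eq_mul]
    linear_combination w i * hu
  rw [LinearMap.comp_apply, this, map_sub, map_smul, LinearMap.mem_ker.mp hv, smul_zero, sub_zero]

end Cover

section Decomposition

variable {R : Type} [CommRing R]

theorem exists_projections {I J : Ideal R} (hIJ : I ⊓ J = ⊥) [IsLocalRing R]
    (hm : I ⊔ J = maximalIdeal R) :
    ∃ (p : maximalIdeal R →ₗ[R] I) (q : maximalIdeal R →ₗ[R] J),
      ∀ x : maximalIdeal R, (p x : R) + q x = x := by
  let c : (I × J) →ₗ[R] R := I.subtype.coprod J.subtype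
  have hc : Function.Injective c := by
    rw [← LinearMap.ker_eq_bot, LinearMap.ker_coprod_of_disjoint_range _ _ (by
      simpa [disjoint_iff] using hIJ)]
    simp
  have hr : LinearMap.range c = maximalIdeal R := by
    simp [c, LinearMap.range_coprod, hm]
  let e : (I × J) ≃ₗ[R] maximalIdeal R :=
    (LinearEquiv.ofInjective c hc).trans (LinearEquiv.ofEq _ _ hr)
  refine ⟨LinearMap.fst R I J ∘ₗ e.symm.toLinearMap, LinearMap.snd R I J ∘ₗ e.symm.toLinearMap,
    fun x => ?_⟩
  have : (e (e.symm x) : R) = x := by rw [e.apply_symm_apply]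
  exact this

theorem eq_of_add_eq_add {I J : Ideal R} (hIJ : I ⊓ J = ⊥) {a a' b b' : R} (ha : a ∈ I)
    (ha' : a' ∈ I) (hb : b ∈ J) (hb' : b' ∈ J) (h : a + b = a' + b') : a = a' ∧ b = b' := by
  have h1 : a - a' = b' - b := by linear_combination h
  have h2 : a - a' ∈ I ⊓ J := ⟨I.sub_mem ha ha', h1 ▸ J.sub_mem hb' hb⟩
  rw [hIJ, Submodule.mem_bot] at h2
  exact ⟨sub_eq_zero.mp h2, (sub_eq_zero.mp (h1.symm.trans h2)).symm⟩

end Decomposition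

/-- `Ext^i_R(L, N)` vanishes for all large `i`. -/
def ExtEventuallyVanishes (R : Type) [CommRing R] (L N : Type) [AddCommGroup L] [Module R L]
    [AddCommGroup N] [Module R N] : Prop :=
  ∃ n : ℕ, ∀ i ≥ n, ExtVanishes R L N i

namespace ExtEventuallyVanishes

variable {R : Type} [CommRing R] {A B C N : Type}
  [AddCommGroup A] [Module R A] [AddCommGroup B] [Module R B] [AddCommGroup C] [Module R C]
  [AddCommGroup N] [Module R N]

theorem of_retract (s : A →ₗ[R] B) (r : B →ₗ[R] A) (hrs : r ∘ₗ s = LinearMap.id)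
    (h : ExtEventuallyVanishes R B N) : ExtEventuallyVanishes R A N :=
  h.imp fun _ hn i hi => (hn i hi).of_retract s r hrs

theorem ker_of_projective [Module.Projective R B] {φ : B →ₗ[R] C} (hφ : Function.Surjective φ)
    (h : ExtEventuallyVanishes R C N) : ExtEventuallyVanishes R (LinearMap.ker φ) N := by
  obtain ⟨n, hn⟩ := h
  refine ⟨n + 1, fun i hi => ?_⟩
  obtain ⟨i, rfl⟩ : ∃ i', i = i' + 1 := ⟨i - 1, by omega⟩
  exact ExtVanishes.left (Submodule.injective_subtype _) (LinearMap.exact_subtype_ker_map φ) hφ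
    (ExtVanishes.of_projective i) (hn _ (by omega))

end ExtEventuallyVanishes

section FiberProduct

variable {R : Type} [CommRing R] [IsLocalRing R] {N : Type} [AddCommGroup N] [Module R N]

theorem ExtEventuallyVanishes.ideal_of_annihilates {I J : Ideal R} (hIJ : I ⊓ J = ⊥)
    (hm : I ⊔ J = maximalIdeal R) {A : Type} [AddCommGroup A] [Module R A] [Module.Finite R A]
    [Nontrivial A] (hJA : ∀ j ∈ J, ∀ a : A, j • a = 0) (h : ExtEventuallyVanishes R A N) :
    ExtEventuallyVanishes R J N := by
  classical
  obtain ⟨p, q, hpq⟩ := exists_projections hIJ hm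
  obtain ⟨n, φ, hφ, hmin⟩ := exists_minimal_cover (R := R) A
  have : Nonempty (Fin n) := by
    by_contra hne
    rw [not_nonempty_iff] at hne
    have := hφ.subsingleton
    exact false_of_nontrivial_of_subsingleton A
  obtain ⟨i⟩ := this
  refine (h.ker_of_projective hφ).of_retract
    (LinearMap.codRestrict _ (LinearMap.single R (fun _ : Fin n => R) i ∘ₗ J.subtype) fun j => ?_)
    (q ∘ₗ LinearMap.codRestrict (maximalIdeal R)
      (LinearMap.proj i ∘ₗ (LinearMap.ker φ).subtype) fun v => hmin v v.2 i) ?_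
  · have : LinearMap.single R (fun _ : Fin n => R) i (j : R) = (j : R) • Pi.single i 1 := by
      rw [LinearMap.single_apply, ← Pi.single_smul', smul_eq_mul, mul_one]
    simp only [LinearMap.comp_apply, Submodule.subtype_apply, LinearMap.mem_ker]
    rw [this, map_smul]
    exact hJA j j.2 _
  · ext j
    have hj : (j : R) ∈ maximalIdeal R := hm ▸ Ideal.mem_sup_right j.2
    have h1 := (eq_of_add_eq_add hIJ (p ⟨j, hj⟩).2 I.zero_mem (q ⟨j, hj⟩).2 j.2
      (by rw [hpq]; simp)).2
    rw [LinearMap.id_apply]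
    refine Eq.trans (congrArg (fun x => (q x : R)) (Subtype.ext ?_)) h1
    change (Pi.single i (j : R) : Fin n → R) i = j
    exact Pi.single_eq_same i _

theorem ExtEventuallyVanishes.residueField {I J : Ideal R} (hIJ : I ⊓ J = ⊥)
    (hm : I ⊔ J = maximalIdeal R) (hI : ExtEventuallyVanishes R I N)
    (hJ : ExtEventuallyVanishes R J N) : ExtEventuallyVanishes R (R ⧸ maximalIdeal R) N := by
  obtain ⟨p, q, hpq⟩ := exists_projections hIJ hm
  obtain ⟨n₁, h₁⟩ := hI
  obtain ⟨n₂, h₂⟩ := hJ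
  refine ⟨max n₁ n₂ + 2, fun i hi => ?_⟩
  obtain ⟨i, rfl⟩ : ∃ i', i = i' + 2 := ⟨i - 2, by omega⟩
  have hIm : I ≤ maximalIdeal R := hm ▸ le_sup_left
  refine ExtVanishes.right (f := (maximalIdeal R).subtype) (g := (maximalIdeal R).mkQ)
    (Submodule.injective_subtype _) (LinearMap.exact_subtype_mkQ _) (Submodule.mkQ_surjective _)
    (ExtVanishes.middle (f := Submodule.inclusion hIm) (g := q)
      (Submodule.inclusion_injective _) (fun x => ?_) (fun j => ?_)
      (h₁ _ (by omega)) (h₂ _ (by omega))) (ExtVanishes.of_projective _)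
  · constructor
    · intro hx
      refine ⟨p x, Subtype.ext ?_⟩
      have := hpq x
      rw [hx] at this
      simpa using this
    · rintro ⟨a, rfl⟩
      refine Subtype.ext ?_
      exact (eq_of_add_eq_add hIJ (p _).2 a.2 (q (Submodule.inclusion hIm a)).2 J.zero_mem
        (by rw [hpq]; simp)).2
  · have hj : (j : R) ∈ maximalIdeal R := hm ▸ Ideal.mem_sup_right j.2
    exact ⟨⟨j, hj⟩, Subtype.ext (eq_of_add_eq_add hIJ (p ⟨j, hj⟩).2 I.zero_mem (q ⟨j, hj⟩).2 j.2
      (by rw [hpq]; simp)).2⟩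

theorem ExtEventuallyVanishes.ideal_of_ker {I J : Ideal R} [IsNoetherianRing R] (hIJ : I ⊓ J = ⊥)
    (hm : I ⊔ J = maximalIdeal R) {n m : ℕ} (ψ : (Fin n → R) →ₗ[R] (Fin m → R))
    (hψ : ∀ v ∈ LinearMap.ker ψ, ∀ i, v i ∈ maximalIdeal R)
    (h : ExtEventuallyVanishes R (LinearMap.ker ψ) N) {v : Fin n → R}
    (hv : v ∈ LinearMap.ker ψ) {i : Fin n} (hvi : v i ∉ J) : ExtEventuallyVanishes R J N := by
  obtain ⟨p, q, hpq⟩ := exists_projections hIJ hm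
  let A : Submodule R (Fin n → R) := LinearMap.ker ψ ⊓ Submodule.pi Set.univ fun _ => I
  let c (i : Fin n) : LinearMap.ker ψ →ₗ[R] maximalIdeal R :=
    LinearMap.codRestrict (maximalIdeal R)
      (LinearMap.proj i ∘ₗ (LinearMap.ker ψ).subtype) fun v => hψ v v.2 i
  let P : LinearMap.ker ψ →ₗ[R] (Fin n → R) := LinearMap.pi fun i => I.subtype ∘ₗ p ∘ₗ c i
  have hmem (L : Ideal R) (w : Fin n → R) (hw : ∀ i, w i ∈ L) (j : Fin m) : ψ w j ∈ L := by
    rw [LinearMap.pi_apply_eq_sum_univ ψ w, Finset.sum_apply]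
    exact L.sum_mem fun i _ => L.mul_mem_right _ (hw i)
  have hP : ∀ w, P w ∈ A := fun w => by
    refine ⟨?_, fun i _ => (p (c i w)).2⟩
    let Q : Fin n → R := fun i => q (c i w)
    have hPQ : P w + Q = w := funext fun i => hpq (c i w)
    refine LinearMap.mem_ker.mpr (funext fun j => ?_)
    refine (eq_of_add_eq_add hIJ (hmem I (P w) (fun i => (p (c i w)).2) j) I.zero_mem
      (hmem J Q (fun i => (q (c i w)).2) j) J.zero_mem ?_).1
    rw [← Pi.add_apply, ← map_add, hPQ, LinearMap.mem_ker.mp w.2, Pi.zero_apply, add_zero]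
  have hA : Nontrivial A := by
    refine ⟨⟨⟨P ⟨v, hv⟩, hP _⟩, 0, fun h0 => hvi ?_⟩⟩
    have h1 : (p (c i ⟨v, hv⟩) : R) = 0 := congrFun (congrArg Subtype.val h0) i
    have h2 := hpq (c i ⟨v, hv⟩)
    rw [h1, zero_add] at h2
    have h3 : (q (c i ⟨v, hv⟩) : R) = v i := h2
    exact h3 ▸ (q _).2
  refine ExtEventuallyVanishes.ideal_of_annihilates hIJ hm (A := A) (fun j hj a => ?_)
    (h.of_retract (Submodule.inclusion inf_le_left) (P.codRestrict A hP) ?_)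
  · refine Subtype.ext (funext fun i => ?_)
    have : j * (a : Fin n → R) i ∈ I ⊓ J :=
      ⟨I.mul_mem_left _ (a.2.2 i trivial), J.mul_mem_right _ hj⟩
    rw [hIJ] at this
    exact this
  · ext a i
    have hai : (a : Fin n → R) i ∈ I := a.2.2 i trivial
    exact (eq_of_add_eq_add hIJ (p _).2 hai (q _).2 J.zero_mem
      ((hpq (c i (Submodule.inclusion inf_le_left a))).trans (add_zero _).symm)).1

/-- Over a noetherian local ring whose maximal ideal is a nontrivial direct sum of two ideals and
annihilates a nonzero element, a finite module `M` with `Ext^i(M, N) = 0` for large `i` is free, or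
else `Ext^i(k, N) = 0` for large `i`. -/
theorem free_or_extEventuallyVanishes_residueField [IsNoetherianRing R] {I J : Ideal R}
    (hIJ : I ⊓ J = ⊥) (hm : I ⊔ J = maximalIdeal R) (hI : I ≠ ⊥) (hJ : J ≠ ⊥) {s : R} (hs : s ≠ 0)
    (hsm : ∀ x ∈ maximalIdeal R, x * s = 0) (M : Type) [AddCommGroup M] [Module R M]
    [Module.Finite R M] (h : ExtEventuallyVanishes R M N) :
    Module.Free R M ∨ ExtEventuallyVanishes R (R ⧸ maximalIdeal R) N := by
  obtain ⟨m, φ, hφ, hφm⟩ := exists_minimal_cover (R := R) M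
  obtain ⟨n, φ', hφ', hφm'⟩ := exists_minimal_cover (R := R) (LinearMap.ker φ)
  let ψ : (Fin n → R) →ₗ[R] (Fin m → R) := (LinearMap.ker φ).subtype ∘ₗ φ'
  have hker : LinearMap.ker ψ = LinearMap.ker φ' :=
    LinearMap.ker_comp_of_ker_eq_bot _ (Submodule.ker_subtype _)
  by_cases hψ : LinearMap.ker ψ = ⊥
  · left
    have hn : IsEmpty (Fin n) := by
      by_contra hne
      rw [not_isEmpty_iff] at hne
      obtain ⟨i⟩ := hne
      refine hs ?_
      have h1 : s • Pi.single i (1 : R) ∈ LinearMap.ker ψ := by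
        rw [LinearMap.mem_ker, map_smul]
        ext j
        exact (mul_comm _ _).trans (hsm _ (hφm _ (φ' (Pi.single i 1)).2 j))
      rw [hψ, Submodule.mem_bot] at h1
      simpa using congrFun h1 i
    have hinj : Function.Injective φ := by
      rw [← LinearMap.ker_eq_bot, ← Submodule.subsingleton_iff_eq_bot]
      exact hφ'.subsingleton
    exact Module.Free.of_equiv (LinearEquiv.ofBijective φ ⟨hinj, hφ⟩)
  · right
    have hIJ' : J ⊓ I = ⊥ := by rwa [inf_comm]
    have hm' : J ⊔ I = maximalIdeal R := by rwa [sup_comm]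
    have hmul {I J : Ideal R} (hIJ : I ⊓ J = ⊥) : ∀ a ∈ I, ∀ b : J, a • b = 0 := fun a ha b => by
      have : a * (b : R) ∈ I ⊓ J := ⟨I.mul_mem_right _ ha, J.mul_mem_left _ b.2⟩
      rw [hIJ] at this
      exact Subtype.ext this
    have : Nontrivial I := Submodule.nontrivial_iff_ne_bot.mpr hI
    have : Nontrivial J := Submodule.nontrivial_iff_ne_bot.mpr hJ
    have hK : ExtEventuallyVanishes R (LinearMap.ker ψ) N :=
      hker ▸ (h.ker_of_projective hφ).ker_of_projective hφ'
    have hψm : ∀ v ∈ LinearMap.ker ψ, ∀ i, v i ∈ maximalIdeal R := hker ▸ hφm'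
    obtain ⟨v, hv, hv0⟩ := Submodule.exists_mem_ne_zero_of_ne_bot hψ
    obtain ⟨i, hi⟩ := Function.ne_iff.mp hv0
    have hIof (hJ : ExtEventuallyVanishes R J N) : ExtEventuallyVanishes R I N :=
      .ideal_of_annihilates hIJ' hm' (hmul hIJ) hJ
    have hJof (hI : ExtEventuallyVanishes R I N) : ExtEventuallyVanishes R J N :=
      .ideal_of_annihilates hIJ hm (hmul hIJ') hI
    by_cases hvJ : v i ∈ J
    · have hvI : v i ∉ I := fun hvI => hi (by
        have : v i ∈ I ⊓ J := ⟨hvI, hvJ⟩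
        rwa [hIJ] at this)
      have := hK.ideal_of_ker hIJ' hm' ψ hψm hv hvI
      exact .residueField hIJ hm this (hJof this)
    · have := hK.ideal_of_ker hIJ hm ψ hψm hv hvJ
      exact .residueField hIJ hm (hIof this) this

end FiberProduct

theorem exists_ne_zero_forall_mul_eq_zero_of_depthM_eq_zero {A : Type} [CommRing A] [IsLocalRing A]
    (h : depthM A A = 0) : ∃ s : A, s ≠ 0 ∧ ∀ x ∈ maximalIdeal A, x * s = 0 := by
  have hne : ({n : ℕ∞ | ∃ i : ℕ, n = i ∧ ¬ ExtZero A (A ⧸ maximalIdeal A) A i}).Nonempty := by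
    by_contra hempty
    rw [Set.not_nonempty_iff_eq_empty] at hempty
    have h' : sInf {n : ℕ∞ | ∃ i : ℕ, n = i ∧ ¬ ExtZero A (A ⧸ maximalIdeal A) A i} = 0 := h
    rw [hempty, sInf_empty] at h'
    exact ENat.top_ne_zero h'
  obtain ⟨i, hi, hext⟩ := csInf_mem hne
  have hi0 : i = 0 := by
    have h' : sInf {n : ℕ∞ | ∃ i : ℕ, n = i ∧ ¬ ExtZero A (A ⧸ maximalIdeal A) A i} = 0 := h
    rw [h'] at hi
    exact_mod_cast hi.symm
  subst hi0
  by_contra hcon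
  push Not at hcon
  refine hext (ExtVanishes.extZero_zero_of_forall_eq_zero fun f => ?_)
  by_contra hf
  have hs : f (Submodule.Quotient.mk 1) ≠ 0 := fun h0 => hf (by ext; exact h0)
  obtain ⟨x, hx, hxs⟩ := hcon _ hs
  refine hxs ?_
  rw [← smul_eq_mul, ← map_smul, ← Submodule.Quotient.mk_smul, smul_eq_mul, mul_one,
    (Submodule.Quotient.mk_eq_zero _).mpr hx, map_zero]

section FiberProd

variable {S T k : Type} [CommRing S] [CommRing T] [Field k] {πS : S →+* k} {πT : T →+* k}

theorem mem_fiberProd {x : S × T} : x ∈ fiberProd πS πT ↔ πS x.1 = πT x.2 := Iff.rfl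

theorem ρS_surjective (hT : Function.Surjective πT) : Function.Surjective (ρS πS πT) := fun s => by
  obtain ⟨t, ht⟩ := hT (πS s)
  exact ⟨⟨(s, t), ht.symm⟩, rfl⟩

theorem ρT_surjective (hS : Function.Surjective πS) : Function.Surjective (ρT πS πT) := fun t => by
  obtain ⟨s, hs⟩ := hS (πT t)
  exact ⟨⟨(s, t), hs⟩, rfl⟩

theorem isNoetherianRing_fiberProd [IsNoetherianRing S] [IsNoetherianRing T]
    (hS : Function.Surjective πS) (hT : Function.Surjective πT) :
    IsNoetherianRing (fiberProd πS πT) := by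
  let _ : Algebra (fiberProd πS πT) S := (ρS πS πT).toAlgebra
  let _ : Algebra (fiberProd πS πT) T := (ρT πS πT).toAlgebra
  have : IsNoetherian (fiberProd πS πT) S :=
    isNoetherian_iff'.mpr
      (Submodule.orderIsoOfAlgebraMapSurjective (M := S)
        (ρS_surjective hT)).symm.strictMono.wellFoundedGT
  have : IsNoetherian (fiberProd πS πT) T :=
    isNoetherian_iff'.mpr
      (Submodule.orderIsoOfAlgebraMapSurjective (M := T)
        (ρT_surjective hS)).symm.strictMono.wellFoundedGT
  exact isNoetherian_of_injective
    ((Algebra.linearMap (fiberProd πS πT) S).prod (Algebra.linearMap (fiberProd πS πT) T))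
    fun x y hxy => Subtype.ext hxy

theorem isUnit_fiberProd {x : fiberProd πS πT} (h₁ : IsUnit x.1.1) (h₂ : IsUnit x.1.2) :
    IsUnit x := by
  obtain ⟨u, hu⟩ := h₁.exists_right_inv
  obtain ⟨v, hv⟩ := h₂.exists_right_inv
  have hx : πS x.1.1 = πT x.1.2 := x.2
  have huv : (u, v) ∈ fiberProd πS πT := by
    have h1 : πS x.1.1 * πS u = 1 := by rw [← map_mul, hu, map_one]
    have h2 : πS x.1.1 * πT v = 1 := by rw [hx, ← map_mul, hv, map_one]
    exact mul_left_cancel₀ (left_ne_zero_of_mul_eq_one h1) (h1.trans h2.symm)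
  exact IsUnit.of_mul_eq_one ⟨(u, v), huv⟩ (Subtype.ext (Prod.ext hu hv))

variable [IsLocalRing S] [IsLocalRing T]

theorem isUnit_fiberProd_iff (hS : RingHom.ker πS = maximalIdeal S)
    (hT : RingHom.ker πT = maximalIdeal T) {x : fiberProd πS πT} : IsUnit x ↔ πS x.1.1 ≠ 0 := by
  constructor
  · intro h
    exact ((h.map (ρS πS πT)).map πS).ne_zero
  · intro h
    refine isUnit_fiberProd ?_ ?_
    · rwa [← notMem_maximalIdeal, ← hS]
    · rw [← notMem_maximalIdeal, ← hT, RingHom.mem_ker, ← mem_fiberProd.mp x.2]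
      exact h

theorem isLocalRing_fiberProd (hS : RingHom.ker πS = maximalIdeal S)
    (hT : RingHom.ker πT = maximalIdeal T) : IsLocalRing (fiberProd πS πT) :=
  .of_nonunits_add fun a b ha hb => by
    simp only [mem_nonunits_iff, isUnit_fiberProd_iff hS hT, not_not] at ha hb ⊢
    simpa [ha] using hb

theorem exists_isPrime_ne_maximalIdeal {R : Type} [CommRing R] [IsLocalRing R] [IsNoetherianRing R]
    (h : ¬ IsArtinianRing R) : ∃ p : Ideal R, p.IsPrime ∧ p ≠ maximalIdeal R := by
  by_contra! hcon
  refine h (isArtinianRing_iff_isNoetherianRing_krullDimLE_zero.mpr ⟨‹_›, ?_⟩)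
  exact Ring.krullDimLE_zero_iff.mpr fun p hp => hcon p hp ▸ maximalIdeal.isMaximal R

end FiberProd

/-- Corollary 4.3: over the fiber product `R = S ×ₖ T`, if `depth S = 0`, `S` or `T` is
not artinian, and `M`, `N` are nonzero finitely generated `R`-modules with
`Ext^i_R(M,N) = 0` for all `i ≫ 0`, then `M` is free over `R`. -/
theorem stmt_15 (S T k : Type) [CommRing S] [CommRing T] [Field k]
    [IsNoetherianRing S] [IsNoetherianRing T] [IsLocalRing S] [IsLocalRing T]
    (πS : S →+* k) (πT : T →+* k)
    (hπS : Function.Surjective πS) (hπT : Function.Surjective πT)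
    (hkS : RingHom.ker πS = maximalIdeal S) (hkT : RingHom.ker πT = maximalIdeal T)
    (hS : maximalIdeal S ≠ ⊥) (hT : maximalIdeal T ≠ ⊥)
    (hdS : depthM S S = 0) (hart : ¬ IsArtinianRing S ∨ ¬ IsArtinianRing T)
    (M N : Type) [AddCommGroup M] [Module ↥(fiberProd πS πT) M]
    [Module.Finite ↥(fiberProd πS πT) M] [Nontrivial M]
    [AddCommGroup N] [Module ↥(fiberProd πS πT) N]
    [Module.Finite ↥(fiberProd πS πT) N] [Nontrivial N]
    (hvan : ∃ n : ℕ, ∀ i ≥ n, ExtZero ↥(fiberProd πS πT) M N i) :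
    Module.Free ↥(fiberProd πS πT) M := by
  have hR := isNoetherianRing_fiberProd hπS hπT
  have hloc := isLocalRing_fiberProd hkS hkT
  have hnart : ¬ IsArtinianRing (fiberProd πS πT) := fun h => hart.elim
    (fun hS => hS (ρS_surjective (πS := πS) hπT).isArtinianRing)
    (fun hT => hT (ρT_surjective (πT := πT) hπS).isArtinianRing)
  obtain ⟨p, hp, hpm⟩ := exists_isPrime_ne_maximalIdeal hnart
  have hmax : ∀ x : fiberProd πS πT, x ∈ maximalIdeal (fiberProd πS πT) ↔ πS x.1.1 = 0 :=
    fun x => by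
    rw [mem_maximalIdeal, mem_nonunits_iff, isUnit_fiberProd_iff hkS hkT, not_not]
  have hmaxS : ∀ {s}, s ∈ maximalIdeal S ↔ πS s = 0 := fun {s} => by rw [← hkS, RingHom.mem_ker]
  have hmaxT : ∀ {t}, t ∈ maximalIdeal T ↔ πT t = 0 := fun {t} => by rw [← hkT, RingHom.mem_ker]
  let I : Ideal (fiberProd πS πT) := RingHom.ker (ρT πS πT)
  let J : Ideal (fiberProd πS πT) := RingHom.ker (ρS πS πT)
  have hIJ : I ⊓ J = ⊥ := by
    refine eq_bot_iff.mpr fun x hx => ?_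
    exact Subtype.ext (Prod.ext hx.2 hx.1)
  have hm : I ⊔ J = maximalIdeal (fiberProd πS πT) := by
    apply le_antisymm
    · refine sup_le (fun x hx => ?_) fun x hx => ?_
      · rw [hmax, mem_fiberProd.mp x.2, show x.1.2 = 0 from hx, map_zero]
      · rw [hmax, show x.1.1 = 0 from hx, map_zero]
    · intro x hx
      rw [hmax] at hx
      have hx' : πT x.1.2 = 0 := (mem_fiberProd.mp x.2).symm.trans hx
      refine Submodule.mem_sup.mpr
        ⟨⟨(x.1.1, 0), mem_fiberProd.mpr (by simpa using hx)⟩, rfl,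
          ⟨(0, x.1.2), mem_fiberProd.mpr (by simpa using hx'.symm)⟩, rfl, ?_⟩
      exact Subtype.ext (Prod.ext (add_zero _) (zero_add _))
  have hI : I ≠ ⊥ := fun h => by
    obtain ⟨a, ha, ha0⟩ := Submodule.exists_mem_ne_zero_of_ne_bot hS
    have hmem : (⟨(a, 0), mem_fiberProd.mpr (by simpa using hmaxS.mp ha)⟩ : fiberProd πS πT) ∈ I :=
      rfl
    rw [h, Submodule.mem_bot] at hmem
    exact ha0 (congrArg (fun x => x.1.1) hmem)
  have hJ : J ≠ ⊥ := fun h => by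
    obtain ⟨a, ha, ha0⟩ := Submodule.exists_mem_ne_zero_of_ne_bot hT
    have hmem : (⟨(0, a), mem_fiberProd.mpr (by simpa using (hmaxT.mp ha).symm)⟩ :
      fiberProd πS πT) ∈ J := rfl
    rw [h, Submodule.mem_bot] at hmem
    exact ha0 (congrArg (fun x => x.1.2) hmem)
  obtain ⟨s, hs0, hs⟩ := exists_ne_zero_forall_mul_eq_zero_of_depthM_eq_zero hdS
  have hsm : s ∈ maximalIdeal S := by
    obtain ⟨a, ha, ha0⟩ := Submodule.exists_mem_ne_zero_of_ne_bot hS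
    exact fun hu => ha0 (hu.mul_left_eq_zero.mp (hs a ha))
  let σ : fiberProd πS πT := ⟨(s, 0), mem_fiberProd.mpr (by simpa using hmaxS.mp hsm)⟩
  have hσ0 : σ ≠ 0 := fun h => hs0 (congrArg (fun x => x.1.1) h)
  have hσ : ∀ x ∈ maximalIdeal (fiberProd πS πT), x * σ = 0 := fun x hx =>
    Subtype.ext (Prod.ext (hs _ (hmaxS.mpr ((hmax x).mp hx))) (mul_zero _))
  obtain ⟨n, hn⟩ := hvan
  have hev : ExtEventuallyVanishes (fiberProd πS πT) M N := by
    refine ⟨n + 1, fun i hi => ?_⟩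
    obtain ⟨i, rfl⟩ : ∃ i', i = i' + 1 := ⟨i - 1, by omega⟩
    exact ExtVanishes.of_extZero (hn _ (by omega))
  refine (free_or_extEventuallyVanishes_residueField hIJ hm hI hJ hσ0 hσ M hev).resolve_right ?_
  rintro ⟨n, hn⟩
  have := subsingleton_of_ext_residueField hσ0 hσ hpm hn
  exact false_of_nontrivial_of_subsingleton N
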